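/- (Montgomery–Vaughan inequality) Let (λ_j) be a strictly increasing real sequence with uniform gap λ_{j+1} - λ_j ≥ δ > 0 for all j. Then for all (a_j), (b_j) ∈ ℓ²(ℂ), |∑_{j≠k} a_j conj(b_k)/(λ_j - λ_k)|² ≤ (π²/δ²)(∑_j |a_j|²)(∑_j |b_j|²). -/

import Mathlib

open Real

section HilbertKernel

open Matrix ComplexConjugate
open scoped Matrix.Norms.L2Operator

variable {ι : Type*} [Fintype ι] [DecidableEq ι]

/-- The square of the matrix `(x k - x l)⁻¹` is a commutator with a diagonal matrix, up to a
matrix with nonpositive entries. -/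
theorem sum_inv_sub_mul_inv_sub {x : ι → ℝ} (hx : x.Injective) (k l : ι) :
    ∑ j, (x k - x j)⁻¹ * (x j - x l)⁻¹ =
      (x k - x l)⁻¹ * (∑ j, (x k - x j)⁻¹ - ∑ j, (x l - x j)⁻¹) - 2 * ((x k - x l)⁻¹) ^ 2
        - if k = l then ∑ j, ((x k - x j)⁻¹) ^ 2 else 0 := by
  rcases eq_or_ne k l with rfl | hkl
  · simp only [sub_self, _root_.inv_zero, if_true, zero_pow two_ne_zero, mul_zero, zero_sub,
      ← Finset.sum_neg_distrib]
    refine Finset.sum_congr rfl fun j _ => ?_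
    rw [← neg_sub (x k) (x j), inv_neg]
    ring
  · have key (j : ι) : (x k - x j)⁻¹ * (x j - x l)⁻¹ =
        (x k - x l)⁻¹ * ((x k - x j)⁻¹ - (x l - x j)⁻¹)
          - (if j = k then ((x k - x l)⁻¹) ^ 2 else 0)
          - (if j = l then ((x k - x l)⁻¹) ^ 2 else 0) := by
      have hkl' : x k - x l ≠ 0 := sub_ne_zero.2 (hx.ne hkl)
      rcases eq_or_ne j k with rfl | hjk
      · have : (x l - x j)⁻¹ = -(x j - x l)⁻¹ := by rw [← inv_neg, neg_sub]
        simp only [sub_self, _root_.inv_zero, zero_mul, hkl, this, if_true, if_false]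
        ring
      rcases eq_or_ne j l with rfl | hjl
      · simp only [sub_self, _root_.inv_zero, mul_zero, hjk, if_true, if_false]
        ring
      have h1 : x k - x j ≠ 0 := sub_ne_zero.2 (hx.ne hjk.symm)
      have h2 : x l - x j ≠ 0 := sub_ne_zero.2 (hx.ne hjl.symm)
      rw [← neg_sub (x l) (x j), inv_neg]
      simp only [hjk, hjl, if_false, sub_zero]
      field_simp
      ring
    simp only [key, Finset.sum_sub_distrib, ← Finset.mul_sum, Finset.sum_ite_eq',
      Finset.mem_univ, if_true, hkl, if_false]
    ring

theorem sq_mul_sum_norm_sq_le_of_eigenvector {x : ι → ℝ} (hx : x.Injective) {v : ι → ℂ} {t : ℝ}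
    (hv : ∀ k, ∑ l, ((x k - x l)⁻¹ : ℝ) * v l = Complex.I * t * v k) :
    t ^ 2 * ∑ k, ‖v k‖ ^ 2 ≤ 3 * ∑ k, (∑ j, ((x k - x j)⁻¹) ^ 2) * ‖v k‖ ^ 2 := by
  set A : ι → ι → ℝ := fun k l => (x k - x l)⁻¹ with hA
  set s : ι → ℝ := fun k => ∑ j, A k j
  set T : ι → ℝ := fun k => ∑ j, A k j ^ 2 with hT
  have hanti (k l : ι) : A k l = -A l k := by simp only [hA]; rw [← inv_neg, neg_sub]
  have hsq (k l : ι) : ∑ j, A k j * A j l =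
      A k l * (s k - s l) - 2 * A k l ^ 2 - if k = l then T k else 0 :=
    sum_inv_sub_mul_inv_sub hx k l
  have hv' (k : ι) : ∑ l, (A k l : ℂ) * v l = Complex.I * t * v k := hv k
  have hvc (l : ι) : ∑ k, (A k l : ℂ) * conj (v k) = Complex.I * t * conj (v l) := by
    have := congrArg conj (hv' l)
    simp only [map_sum, map_mul, Complex.conj_ofReal, Complex.conj_I] at this
    simp only [hanti _ l, Complex.ofReal_neg, neg_mul, Finset.sum_neg_distrib, this]
    ring
  have hdouble : ∑ k, ∑ l, conj (v k) * (∑ j, A k j * A j l : ℝ) * v l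
      = -(t ^ 2 * ∑ k, ‖v k‖ ^ 2 : ℝ) := by
    have (k : ι) : ∑ l, conj (v k) * (∑ j, A k j * A j l : ℝ) * v l
        = conj (v k) * ∑ j, A k j * ∑ l, A j l * v l := by
      simp only [Complex.ofReal_sum, Complex.ofReal_mul, Finset.mul_sum, Finset.sum_mul]
      rw [Finset.sum_comm]
      refine Finset.sum_congr rfl fun _ _ => Finset.sum_congr rfl fun _ _ => ?_
      ring
    simp only [this, hv', mul_left_comm (Complex.ofReal (A _ _)), ← Finset.mul_sum]
    push_cast
    rw [Finset.mul_sum, ← Finset.sum_neg_distrib]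
    refine Finset.sum_congr rfl fun k _ => ?_
    rw [← Complex.conj_mul' (v k)]
    linear_combination (t ^ 2 * conj (v k) * v k) * Complex.I_sq
  have hcomm : ∑ k, ∑ l, conj (v k) * (A k l * (s k - s l) : ℝ) * v l = 0 := by
    have e1 : ∑ k, ∑ l, conj (v k) * (A k l * s k : ℝ) * v l
        = ∑ k, Complex.I * t * s k * conj (v k) * v k := by
      refine Finset.sum_congr rfl fun k _ => ?_
      calc _ = s k * conj (v k) * ∑ l, (A k l : ℂ) * v l := by
            rw [Finset.mul_sum]
            refine Finset.sum_congr rfl fun l _ => ?_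
            push_cast; ring
        _ = _ := by rw [hv' k]; ring
    have e2 : ∑ k, ∑ l, conj (v k) * (A k l * s l : ℝ) * v l
        = ∑ k, Complex.I * t * s k * conj (v k) * v k := by
      rw [Finset.sum_comm]
      refine Finset.sum_congr rfl fun l _ => ?_
      calc _ = s l * v l * ∑ k, (A k l : ℂ) * conj (v k) := by
            rw [Finset.mul_sum]
            refine Finset.sum_congr rfl fun l _ => ?_
            push_cast; ring
        _ = _ := by rw [hvc l]; ring
    rw [← sub_eq_zero] at e1
    simp only [mul_sub, sub_mul, Complex.ofReal_sub, Finset.sum_sub_distrib]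
    rw [e2]
    exact e1
  have hid : ((t ^ 2 * ∑ k, ‖v k‖ ^ 2 : ℝ) : ℂ) =
      2 * ∑ k, ∑ l, conj (v k) * (A k l ^ 2 : ℝ) * v l + (∑ k, T k * ‖v k‖ ^ 2 : ℝ) := by
    have hdiag : ∑ k, ∑ l, conj (v k) * ((if k = l then T k else 0 : ℝ) : ℂ) * v l
        = (∑ k, T k * ‖v k‖ ^ 2 : ℝ) := by
      push_cast
      refine Finset.sum_congr rfl fun k _ => ?_
      rw [← Complex.conj_mul' (v k)]
      simp [apply_ite Complex.ofReal]
      ring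
    simp only [hsq, Complex.ofReal_sub, mul_sub, sub_mul, Finset.sum_sub_distrib] at hdouble hcomm
    rw [hdiag] at hdouble
    have h2 : ∑ k, ∑ l, conj (v k) * ((2 * A k l ^ 2 : ℝ) : ℂ) * v l
        = 2 * ∑ k, ∑ l, conj (v k) * (A k l ^ 2 : ℝ) * v l := by
      simp only [Finset.mul_sum]
      refine Finset.sum_congr rfl fun _ _ => Finset.sum_congr rfl fun _ _ => ?_
      push_cast; ring
    linear_combination hdouble - hcomm + h2
  have hcross : ‖∑ k, ∑ l, conj (v k) * (A k l ^ 2 : ℝ) * v l‖ ≤ ∑ k, T k * ‖v k‖ ^ 2 := by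
    calc _ ≤ ∑ k, ∑ l, (A k l ^ 2 * ‖v k‖ ^ 2 / 2 + A k l ^ 2 * ‖v l‖ ^ 2 / 2) := by
          refine (norm_sum_le _ _).trans (Finset.sum_le_sum fun k _ => ?_)
          refine (norm_sum_le _ _).trans (Finset.sum_le_sum fun l _ => ?_)
          rw [norm_mul, norm_mul, RCLike.norm_conj, Complex.norm_real,
            Real.norm_of_nonneg (sq_nonneg _)]
          nlinarith [mul_nonneg (sq_nonneg (A k l)) (sq_nonneg (‖v k‖ - ‖v l‖))]
      _ = _ := by
          simp only [Finset.sum_add_distrib]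
          rw [Finset.sum_comm (f := fun k l => A k l ^ 2 * ‖v l‖ ^ 2 / 2),
            ← Finset.sum_add_distrib]
          refine Finset.sum_congr rfl fun k _ => ?_
          rw [← Finset.sum_add_distrib, hT, Finset.sum_mul]
          refine Finset.sum_congr rfl fun l _ => ?_
          rw [hanti l k]
          ring
  have hre := congrArg Complex.re hid
  simp only [Complex.add_re, Complex.ofReal_re, Complex.mul_re, Complex.re_ofNat,
    Complex.im_ofNat, zero_mul, sub_zero] at hre
  have := (Complex.re_le_norm _).trans hcross
  change _ ≤ 3 * ∑ k, T k * ‖v k‖ ^ 2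
  linarith

theorem norm_sq_inv_sub_matrix_le {x : ι → ℝ} (hx : x.Injective) {C : ℝ} (hC : 0 ≤ C)
    (hT : ∀ k, ∑ j, ((x k - x j)⁻¹) ^ 2 ≤ C) :
    ‖(Matrix.of fun k l => (((x k - x l)⁻¹ : ℝ) : ℂ))‖ ^ 2 ≤ 3 * C := by
  set M : Matrix ι ι ℂ := Matrix.of fun k l => (((x k - x l)⁻¹ : ℝ) : ℂ) with hM
  rcases isEmpty_or_nonempty ι with hι | hι
  · rw [Subsingleton.elim M 0]
    simpa using hC
  set H : Matrix ι ι ℂ := Complex.I • M with hH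
  have hsa : IsSelfAdjoint H := by
    ext k l
    simp [hH, hM]
    rw [← neg_sub, inv_neg]
    simp
  obtain ⟨z, hz, hzn⟩ := spectrum.exists_nnnorm_eq_spectralRadius H
  rw [hsa.spectralRadius_eq_nnnorm] at hzn
  have hnorm : ‖z‖ = ‖M‖ := by
    have h1 : ‖z‖₊ = ‖H‖₊ := by exact_mod_cast hzn
    have h2 : ‖z‖ = ‖H‖ := congrArg NNReal.toReal h1
    rw [h2, hH, norm_smul, Complex.norm_I, one_mul]
  have hzre := hsa.mem_spectrum_eq_re hz
  rw [spectrum.mem_iff, Matrix.isUnit_iff_isUnit_det, isUnit_iff_ne_zero, not_not,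
    ← Matrix.exists_mulVec_eq_zero_iff] at hz
  obtain ⟨v, hv0, hv⟩ := hz
  have heig (k : ι) : ∑ l, ((x k - x l)⁻¹ : ℝ) * v l = Complex.I * (-z.re : ℝ) * v k := by
    have h := congrFun hv k
    rw [Matrix.sub_mulVec, Algebra.algebraMap_eq_smul_one, Matrix.smul_mulVec, Matrix.one_mulVec,
      hH, Matrix.smul_mulVec] at h
    simp only [Pi.sub_apply, Pi.smul_apply, smul_eq_mul, Pi.zero_apply] at h
    change z * v k - Complex.I * ∑ l, ((x k - x l)⁻¹ : ℝ) * v l = 0 at h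
    rw [Complex.ofReal_neg, ← hzre]
    linear_combination Complex.I * h + (∑ l, (((x k - x l)⁻¹ : ℝ) : ℂ) * v l) * Complex.I_sq
  have hmain := sq_mul_sum_norm_sq_le_of_eigenvector hx heig
  have hpos : 0 < ∑ k, ‖v k‖ ^ 2 := by
    obtain ⟨k, hk⟩ := Function.ne_iff.1 hv0
    exact Finset.sum_pos' (fun _ _ => sq_nonneg _)
      ⟨k, Finset.mem_univ k, pow_pos (norm_pos_iff.2 hk) 2⟩
  have hle : ∑ k, (∑ j, ((x k - x j)⁻¹) ^ 2) * ‖v k‖ ^ 2 ≤ C * ∑ k, ‖v k‖ ^ 2 := by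
    rw [Finset.mul_sum]
    exact Finset.sum_le_sum fun k _ => mul_le_mul_of_nonneg_right (hT k) (sq_nonneg _)
  have hzt : ‖M‖ ^ 2 = (-z.re) ^ 2 := by
    rw [← hnorm, hzre, Complex.norm_real, Real.norm_eq_abs, sq_abs, Complex.ofReal_re, neg_sq]
  rw [hzt]
  refine le_of_mul_le_mul_right ?_ hpos
  linarith

theorem norm_sq_sum_mul_conj_mul_inv_sub_le {x : ι → ℝ} (hx : x.Injective) {C : ℝ} (hC : 0 ≤ C)
    (hT : ∀ k, ∑ j, ((x k - x j)⁻¹) ^ 2 ≤ C) (a b : ι → ℂ) :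
    ‖∑ j, ∑ k, a j * conj (b k) * ((x j - x k)⁻¹ : ℝ)‖ ^ 2
      ≤ 3 * C * (∑ j, ‖a j‖ ^ 2) * ∑ k, ‖b k‖ ^ 2 := by
  set M : Matrix ι ι ℂ := Matrix.of fun k l => (((x k - x l)⁻¹ : ℝ) : ℂ) with hM
  set u : EuclideanSpace ℂ ι := WithLp.toLp 2 fun k => conj (b k) with hu
  set w : EuclideanSpace ℂ ι := WithLp.toLp 2 fun j => conj (a j) with hw
  have hun : ‖u‖ ^ 2 = ∑ k, ‖b k‖ ^ 2 := by simp [EuclideanSpace.norm_sq_eq, hu]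
  have hwn : ‖w‖ ^ 2 = ∑ k, ‖a k‖ ^ 2 := by simp [EuclideanSpace.norm_sq_eq, hw]
  have hinner : ∑ j, ∑ k, a j * conj (b k) * ((x j - x k)⁻¹ : ℝ)
      = inner ℂ w ((EuclideanSpace.equiv ι ℂ).symm (M *ᵥ u.ofLp)) := by
    rw [EuclideanSpace.inner_eq_star_dotProduct]
    simp only [dotProduct, mulVec, hu, hw, hM, PiLp.coe_symm_continuousLinearEquiv, of_apply,
      Pi.star_apply, RCLike.star_def, Complex.conj_conj, Finset.sum_mul]
    refine Finset.sum_congr rfl fun _ _ => Finset.sum_congr rfl fun _ _ => ?_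
    ring
  have hle : ‖∑ j, ∑ k, a j * conj (b k) * ((x j - x k)⁻¹ : ℝ)‖ ≤ ‖w‖ * (‖M‖ * ‖u‖) := by
    rw [hinner]
    exact (norm_inner_le_norm _ _).trans
      (mul_le_mul_of_nonneg_left (Matrix.l2_opNorm_mulVec M u) (norm_nonneg _))
  calc _ ≤ (‖w‖ * (‖M‖ * ‖u‖)) ^ 2 := pow_le_pow_left₀ (norm_nonneg _) hle 2
    _ = ‖M‖ ^ 2 * ‖w‖ ^ 2 * ‖u‖ ^ 2 := by ring
    _ ≤ _ := by
      rw [hun, hwn]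
      gcongr
      exact norm_sq_inv_sub_matrix_le hx hC hT

end HilbertKernel

theorem hasSum_int_one_div_sq : HasSum (fun n : ℤ => 1 / (n : ℝ) ^ 2) (π ^ 2 / 3) := by
  have h := HasSum.of_nat_of_neg (f := fun n : ℤ => 1 / (n : ℝ) ^ 2)
    (by simpa using hasSum_zeta_two) (by simpa using hasSum_zeta_two)
  have e : π ^ 2 / 6 + π ^ 2 / 6 - 1 / ((0 : ℤ) : ℝ) ^ 2 = π ^ 2 / 3 := by
    simp only [Int.cast_zero, zero_pow two_ne_zero, div_zero]
    ring
  rwa [e] at h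

theorem mul_abs_sub_le_abs_sub {x : ℕ → ℝ} {δ : ℝ} (hgap : ∀ j, x (j + 1) - x j ≥ δ) (k j : ℕ) :
    δ * |(k : ℝ) - j| ≤ |x k - x j| := by
  have hmono : Monotone fun n : ℕ => x n - δ * n :=
    monotone_nat_of_le_succ fun n => by push_cast; linarith [hgap n]
  wlog hjk : j ≤ k generalizing j k
  · rw [abs_sub_comm, abs_sub_comm (x k)]
    exact this j k (le_of_not_ge hjk)
  have h := hmono hjk
  have hc : (j : ℝ) ≤ k := Nat.cast_le.2 hjk
  rw [abs_of_nonneg (sub_nonneg.2 hc)]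
  refine le_trans ?_ (le_abs_self _)
  dsimp only at h
  linarith

theorem sum_inv_sub_sq_le {x : ℕ → ℝ} {δ : ℝ} (hδ : 0 < δ) (hgap : ∀ j, x (j + 1) - x j ≥ δ)
    (N : ℕ) (k : Fin N) : ∑ j : Fin N, ((x k - x j)⁻¹) ^ 2 ≤ π ^ 2 / (3 * δ ^ 2) := by
  have hterm (j : Fin N) :
      ((x k - x j)⁻¹) ^ 2 ≤ 1 / δ ^ 2 * (1 / (((k : ℤ) - (j : ℤ) : ℤ) : ℝ) ^ 2) := by
    rcases eq_or_ne k j with rfl | hkj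
    · simp
    have hne : (k : ℝ) - (j : ℝ) ≠ 0 :=
      sub_ne_zero.2 (Nat.cast_injective.ne (Fin.val_injective.ne hkj))
    have hpos : 0 < δ * |(k : ℝ) - (j : ℝ)| := mul_pos hδ (abs_pos.2 hne)
    have h := pow_le_pow_left₀ hpos.le (mul_abs_sub_le_abs_sub hgap k j) 2
    rw [mul_pow, sq_abs, sq_abs] at h
    push_cast
    rw [inv_pow, ← one_div, one_div_mul_one_div]
    exact one_div_le_one_div_of_le (by positivity) h
  have hinj : Function.Injective fun j : Fin N => (k : ℤ) - (j : ℤ) := fun i j h => by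
    ext
    dsimp only at h
    omega
  calc _ ≤ ∑ j : Fin N, 1 / δ ^ 2 * (1 / (((k : ℤ) - (j : ℤ) : ℤ) : ℝ) ^ 2) :=
        Finset.sum_le_sum fun j _ => hterm j
    _ = 1 / δ ^ 2 * ∑ n ∈ Finset.univ.map ⟨_, hinj⟩, 1 / (n : ℝ) ^ 2 := by
        rw [Finset.sum_map, Finset.mul_sum]
        rfl
    _ ≤ 1 / δ ^ 2 * (π ^ 2 / 3) := by
        gcongr
        exact sum_le_hasSum _ (fun _ _ => by positivity) hasSum_int_one_div_sq
    _ = _ := by field_simp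

theorem tendsto_range_product_range :
    Filter.Tendsto (fun N : ℕ => Finset.range N ×ˢ Finset.range N) Filter.atTop Filter.atTop := by
  refine Filter.tendsto_atTop_finset_of_monotone
    (fun m n h => Finset.product_subset_product (Finset.range_mono h) (Finset.range_mono h))
    fun p => ⟨max p.1 p.2 + 1, ?_⟩
  simp only [Finset.mem_product, Finset.mem_range]
  omega

theorem stmt_13 (lam : ℕ → ℝ) (δ : ℝ) (hδ : 0 < δ)
    (hmono : StrictMono lam) (hgap : ∀ j, lam (j + 1) - lam j ≥ δ)
    (a b : ℕ → ℂ)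
    (ha : Summable fun j => ‖a j‖ ^ 2) (hb : Summable fun j => ‖b j‖ ^ 2)
    (hsum : Summable fun p : ℕ × ℕ =>
      if p.1 = p.2 then 0 else a p.1 * (starRingEnd ℂ) (b p.2) / ((lam p.1 : ℂ) - (lam p.2 : ℂ))) :
    ‖∑' p : ℕ × ℕ,
        if p.1 = p.2 then 0 else a p.1 * (starRingEnd ℂ) (b p.2) / ((lam p.1 : ℂ) - (lam p.2 : ℂ))‖ ^ 2
      ≤ π ^ 2 / δ ^ 2 * (∑' j, ‖a j‖ ^ 2) * (∑' j, ‖b j‖ ^ 2) := by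
  refine le_of_tendsto ((hsum.hasSum.comp tendsto_range_product_range).norm.pow 2)
    (Filter.Eventually.of_forall fun N => ?_)
  have hfin := norm_sq_sum_mul_conj_mul_inv_sub_le (x := fun j : Fin N => lam j)
    (hmono.injective.comp Fin.val_injective) (by positivity) (sum_inv_sub_sq_le hδ hgap N)
    (fun j => a j) (fun j => b j)
  have hsum_eq : ∑ p ∈ Finset.range N ×ˢ Finset.range N,
      (if p.1 = p.2 then 0 else
        a p.1 * (starRingEnd ℂ) (b p.2) / ((lam p.1 : ℂ) - (lam p.2 : ℂ)))
      = ∑ j : Fin N, ∑ k : Fin N,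
        a j * (starRingEnd ℂ) (b k) * ((lam j - lam k)⁻¹ : ℝ) := by
    rw [Finset.sum_product, Finset.sum_range]
    refine Finset.sum_congr rfl fun j _ => ?_
    rw [Finset.sum_range]
    refine Finset.sum_congr rfl fun k _ => ?_
    split_ifs with h
    · simp [show (j : ℕ) = k from h]
    · push_cast
      rw [div_eq_mul_inv]
  have hle (c : ℕ → ℂ) (hc : Summable fun j => ‖c j‖ ^ 2) :
      ∑ j : Fin N, ‖c j‖ ^ 2 ≤ ∑' j, ‖c j‖ ^ 2 := by
    rw [← Finset.sum_range fun j => ‖c j‖ ^ 2]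
    exact hc.sum_le_tsum _ fun _ _ => sq_nonneg _
  simp only [Function.comp_apply]
  rw [hsum_eq]
  refine hfin.trans ?_
  rw [show 3 * (π ^ 2 / (3 * δ ^ 2)) = π ^ 2 / δ ^ 2 by field_simp]
  gcongr
  · exact hle a ha
  · exact hle b hb
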